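/- Let N ≥ 1 and let d, d_1, …, d_N, ρ_1, …, ρ_N be natural numbers satisfying the interleaving 0 ≤ d_1 < ρ_N ≤ d_2 < ρ_{N−1} ≤ d_3 < ⋯ ≤ d_N < ρ_1 ≤ d (that is, d_i < ρ_{N+1−i} ≤ d_{i+1} for 1 ≤ i ≤ N, where d_{N+1} := d). Set m := d + (d_1+⋯+d_N) − (ρ_1+⋯+ρ_N); then m ≥ 0 and there exists an (N+1)-dimensional ℂ-linear subspace V of the space of complex polynomials of degree at most d such that: (i) the set of degrees of nonzero elements of V is exactly {d_1, …, d_N, d}; (ii) the set of root multiplicities at 0 of nonzero elements of V is exactly {0, ρ_N, ρ_{N−1}, …, ρ_1}; (iii) V contains a polynomial whose root multiplicity at −1 equals m+N; and (iv) the Wronskian of any basis of V equals c·x^{ρ_1+⋯+ρ_N − N(N+1)/2}·(x+1)^m for some nonzero constant c ∈ ℂ. -/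

import Mathlib

open Polynomial

/-- The Wronskian of `n` polynomials: the determinant of the `n × n` matrix whose
`(i,j)` entry is the `j`-th derivative of `f i` (`0 ≤ j ≤ n-1`). -/
noncomputable def polyWronskian {n : ℕ} (f : Fin n → Polynomial ℂ) : Polynomial ℂ :=
  Matrix.det (Matrix.of fun i j : Fin n => Polynomial.derivative^[(j : ℕ)] (f i))

/-- Coefficients of `X^j` times the `j`-th derivative. -/
lemma coeff_X_pow_mul_iter (p : ℂ[X]) (j k : ℕ) :
    (X ^ j * derivative^[j] p).coeff k = (k.descFactorial j : ℂ) * p.coeff k := by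
  rw [coeff_X_pow_mul']
  split_ifs with h
  · rw [coeff_iterate_derivative, Nat.sub_add_cancel h, nsmul_eq_mul]
  · rw [Nat.descFactorial_of_lt (by omega)]; simp

section blocks

variable {n : ℕ} (p : Fin n → ℂ[X]) (R D : Fin n → ℕ)

/-- The polynomials `p i` are supported on disjoint consecutive blocks `[R i, D i]`. -/
structure Blocks : Prop where
  le : ∀ i, R i ≤ D i
  lt : ∀ i j, i < j → D i < R j
  supp : ∀ i k, (p i).coeff k ≠ 0 ↔ R i ≤ k ∧ k ≤ D i

variable {p R D}

lemma Blocks.unique (h : Blocks p R D) {i j : Fin n} {k : ℕ}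
    (hi : R i ≤ k ∧ k ≤ D i) (hj : R j ≤ k ∧ k ≤ D j) : i = j := by
  rcases lt_trichotomy i j with hl | hl | hl
  · have := h.lt _ _ hl; omega
  · exact hl
  · have := h.lt _ _ hl; omega

lemma Blocks.coeff_comb (h : Blocks p R D) (a : Fin n → ℂ) {i : Fin n} {k : ℕ}
    (hi : R i ≤ k ∧ k ≤ D i) : (∑ j, a j • p j).coeff k = a i * (p i).coeff k := by
  rw [finsetSum_coeff, Finset.sum_eq_single i]
  · simp
  · intro j _ hj
    have : (p j).coeff k = 0 := by
      by_contra hne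
      exact hj (h.unique ((h.supp _ _).1 hne) hi)
    simp [this]
  · simp

lemma Blocks.exists_of_coeff (h : Blocks p R D) (a : Fin n → ℂ) {k : ℕ}
    (hk : (∑ j, a j • p j).coeff k ≠ 0) : ∃ i, a i ≠ 0 ∧ R i ≤ k ∧ k ≤ D i := by
  rw [finsetSum_coeff] at hk
  obtain ⟨i, _, hi⟩ := Finset.exists_ne_zero_of_sum_ne_zero hk
  rw [coeff_smul, smul_eq_mul] at hi
  exact ⟨i, left_ne_zero_of_mul hi, (h.supp _ _).1 (right_ne_zero_of_mul hi)⟩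

lemma Blocks.coeff_ne (h : Blocks p R D) (a : Fin n → ℂ) {i : Fin n} {k : ℕ}
    (ha : a i ≠ 0) (hi : R i ≤ k ∧ k ≤ D i) : (∑ j, a j • p j).coeff k ≠ 0 := by
  rw [h.coeff_comb a hi]
  exact mul_ne_zero ha ((h.supp _ _).2 hi)

lemma Blocks.linInd (h : Blocks p R D) : LinearIndependent ℂ p := by
  rw [Fintype.linearIndependent_iff]
  intro a ha i
  by_contra hne
  apply h.coeff_ne a hne ⟨le_refl _, h.le i⟩
  rw [ha]; simp

lemma Blocks.ne_zero (h : Blocks p R D) (i : Fin n) : p i ≠ 0 := h.linInd.ne_zero i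

lemma Blocks.natDegree (h : Blocks p R D) (i : Fin n) : (p i).natDegree = D i := by
  apply le_antisymm
  · have := (h.supp i _).1 (leadingCoeff_ne_zero.2 (h.ne_zero i))
    exact this.2
  · exact le_natDegree_of_ne_zero ((h.supp i _).2 ⟨h.le i, le_refl _⟩)

lemma Blocks.natTrailingDegree (h : Blocks p R D) (i : Fin n) :
    (p i).natTrailingDegree = R i := by
  apply le_antisymm
  · exact natTrailingDegree_le_of_ne_zero ((h.supp i _).2 ⟨le_refl _, h.le i⟩)
  · have := (h.supp i _).1 (trailingCoeff_nonzero_iff_nonzero.2 (h.ne_zero i))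
    exact this.1

lemma Blocks.degrees (h : Blocks p R D) :
    {k : ℕ | ∃ g ∈ Submodule.span ℂ (Set.range p), g ≠ 0 ∧ g.natDegree = k} = Set.range D := by
  ext k
  constructor
  · rintro ⟨g, hg, h0, rfl⟩
    obtain ⟨a, rfl⟩ := (Submodule.mem_span_range_iff_exists_fun ℂ).1 hg
    obtain ⟨i, hi, hR, hD⟩ := h.exists_of_coeff a (leadingCoeff_ne_zero.2 h0)
    exact ⟨i, le_antisymm (le_natDegree_of_ne_zero (h.coeff_ne a hi ⟨h.le i, le_refl _⟩)) hD⟩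
  · rintro ⟨i, rfl⟩
    exact ⟨p i, Submodule.subset_span ⟨i, rfl⟩, h.ne_zero i, h.natDegree i⟩

lemma Blocks.mults (h : Blocks p R D) :
    {k : ℕ | ∃ g ∈ Submodule.span ℂ (Set.range p), g ≠ 0 ∧ rootMultiplicity 0 g = k}
      = Set.range R := by
  ext k
  constructor
  · rintro ⟨g, hg, h0, rfl⟩
    obtain ⟨a, rfl⟩ := (Submodule.mem_span_range_iff_exists_fun ℂ).1 hg
    obtain ⟨i, hi, hR, hD⟩ := h.exists_of_coeff a (trailingCoeff_nonzero_iff_nonzero.2 h0)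
    refine ⟨i, ?_⟩
    rw [rootMultiplicity_eq_natTrailingDegree']
    exact le_antisymm hR
      (natTrailingDegree_le_of_ne_zero (h.coeff_ne a hi ⟨le_refl _, h.le i⟩))
  · rintro ⟨i, rfl⟩
    refine ⟨p i, Submodule.subset_span ⟨i, rfl⟩, h.ne_zero i, ?_⟩
    rw [rootMultiplicity_eq_natTrailingDegree', h.natTrailingDegree]

lemma Blocks.strictMono (h : Blocks p R D) : StrictMono R := fun i j hij =>
  lt_of_le_of_lt (h.le i) (h.lt i j hij)

/-- The Wronskian, up to a power of `X`, is `X^(ΣR) H` with `H(0) ≠ 0`. -/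
lemma Blocks.wronskian_factor (h : Blocks p R D) :
    ∃ H : ℂ[X], H.eval 0 ≠ 0 ∧
      X ^ (∑ j : Fin n, (j : ℕ)) * polyWronskian p = X ^ (∑ i, R i) * H ∧
      (X ^ (∑ j : Fin n, (j : ℕ)) * polyWronskian p).natDegree ≤ ∑ i, D i := by
  have e1 : X ^ (∑ j : Fin n, (j : ℕ)) * polyWronskian p =
      Matrix.det (Matrix.of fun i j : Fin n => X ^ (j : ℕ) * derivative^[(j : ℕ)] (p i)) := by
    rw [polyWronskian, ← Finset.prod_pow_eq_pow_sum, ← Matrix.det_mul_row]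
    rfl
  have hdvd : ∀ i j : Fin n, ∃ q : ℂ[X],
      X ^ (j : ℕ) * derivative^[(j : ℕ)] (p i) = X ^ (R i) * q := by
    intro i j
    change (X : ℂ[X]) ^ (R i) ∣ _
    rw [X_pow_dvd_iff]
    intro k hk
    rw [coeff_X_pow_mul_iter]
    have : (p i).coeff k = 0 := by
      by_contra hne
      have := (h.supp _ _).1 hne
      omega
    simp [this]
  choose q hq using hdvd
  refine ⟨Matrix.det (Matrix.of q), ?_, ?_, ?_⟩
  · have e2 : (Matrix.det (Matrix.of q)).eval 0 =
        Matrix.det (Matrix.of fun i j : Fin n => (p i).coeff (R i) *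
          (Matrix.of fun i j : Fin n => eval ((R i : ℕ) : ℂ) (descPochhammer ℂ j)) i j) := by
      rw [← coe_evalRingHom, RingHom.map_det]
      congr 1
      ext i j
      simp only [RingHom.mapMatrix_apply, Matrix.map_apply, Matrix.of_apply, coe_evalRingHom]
      rw [descPochhammer_eval_eq_descFactorial, mul_comm, ← coeff_X_pow_mul_iter, hq,
        ← coeff_zero_eq_eval_zero]
      simpa using (coeff_X_pow_mul (q i j) (R i) 0).symm
    rw [e2, Matrix.det_mul_column, ← Matrix.det_eval_matrixOfPolynomials_eq_det_vandermonde
      (fun i => ((R i : ℕ) : ℂ)) (fun j => descPochhammer ℂ j)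
      (fun i => descPochhammer_natDegree ℂ i) (fun i => monic_descPochhammer ℂ i)]
    apply mul_ne_zero
    · rw [Finset.prod_ne_zero_iff]
      intro i _
      exact (h.supp _ _).2 ⟨le_refl _, h.le i⟩
    · rw [Matrix.det_vandermonde_ne_zero_iff]
      exact Nat.cast_injective.comp h.strictMono.injective
  · rw [e1, ← Finset.prod_pow_eq_pow_sum, ← Matrix.det_mul_column]
    congr 1
    ext1 i j
    exact hq i j
  · rw [e1, Matrix.det_apply]
    apply natDegree_sum_le_of_forall_le
    intro σ _
    have hs : (Equiv.Perm.sign σ • ∏ i, (Matrix.of fun i j : Fin n =>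
        X ^ (j : ℕ) * derivative^[(j : ℕ)] (p i)) (σ i) i).natDegree ≤
        (∏ i, (Matrix.of fun i j : Fin n =>
        X ^ (j : ℕ) * derivative^[(j : ℕ)] (p i)) (σ i) i).natDegree := by
      rcases Int.units_eq_one_or (Equiv.Perm.sign σ) with hh | hh <;> rw [hh] <;> simp
    refine hs.trans ((natDegree_prod_le _ _).trans ?_)
    rw [← Equiv.sum_comp σ D]
    apply Finset.sum_le_sum
    intro i _
    rw [Matrix.of_apply, natDegree_le_iff_coeff_eq_zero]
    intro k hk
    rw [coeff_X_pow_mul_iter]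
    have : (p (σ i)).coeff k = 0 := by
      by_contra hne
      have := (h.supp _ _).1 hne
      omega
    simp [this]

end blocks

lemma dvd_iter_derivative (q : ℂ[X]) (e M : ℕ) (hq : (X + 1) ^ (M + e) ∣ q) :
    (X + 1) ^ M ∣ derivative^[e] q := by
  have := pow_sub_dvd_iterate_derivative_of_pow_dvd e hq
  simpa using this

lemma wronskian_comb {n : ℕ} (f p : Fin n → ℂ[X]) (A : Matrix (Fin n) (Fin n) ℂ)
    (hA : ∀ i, f i = ∑ j, A i j • p j) : polyWronskian f = C A.det * polyWronskian p := by
  have : (Matrix.of fun i j : Fin n => derivative^[(j : ℕ)] (f i)) =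
      (C : ℂ →+* ℂ[X]).mapMatrix A *
        (Matrix.of fun i j : Fin n => derivative^[(j : ℕ)] (p i)) := by
    ext1 i j
    rw [Matrix.of_apply, hA, iterate_derivative_sum, Matrix.mul_apply]
    apply Finset.sum_congr rfl
    intro k _
    rw [iterate_derivative_smul, smul_eq_C_mul]
    rfl
  rw [polyWronskian, this, Matrix.det_mul, ← RingHom.map_det]
  rfl

lemma dvd_wronskian {n : ℕ} (p : Fin n → ℂ[X]) (i0 : Fin n) (M : ℕ)
    (hq : (X + 1) ^ (M + n - 1) ∣ ∑ j, p j) : (X + 1) ^ M ∣ polyWronskian p := by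
  have h1 := Matrix.det_updateRow_sum
    (Matrix.of fun i j : Fin n => derivative^[(j : ℕ)] (p i)) i0 (fun _ => 1)
  rw [one_smul] at h1
  rw [polyWronskian, ← h1, Matrix.det_apply]
  apply Finset.dvd_sum
  intro σ _
  have hd : (X + 1 : ℂ[X]) ^ M ∣ ∏ i, (Matrix.of fun i j : Fin n => derivative^[(j : ℕ)]
      (p i)).updateRow i0 (∑ k, (1 : ℂ[X]) • (Matrix.of fun i j : Fin n =>
        derivative^[(j : ℕ)] (p i)) k) (σ i) i := by
    refine dvd_trans ?_ (Finset.dvd_prod_of_mem _ (Finset.mem_univ (σ.symm i0)))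
    rw [Equiv.apply_symm_apply, Matrix.updateRow_self]
    have : (∑ k, (1 : ℂ[X]) • (Matrix.of fun i j : Fin n =>
        derivative^[(j : ℕ)] (p i)) k) (σ.symm i0) =
        derivative^[(σ.symm i0 : ℕ)] (∑ j, p j) := by
      rw [iterate_derivative_sum, Finset.sum_apply]
      simp
    rw [this]
    apply dvd_iter_derivative
    refine dvd_trans (pow_dvd_pow _ ?_) hq
    have := (σ.symm i0).2
    omega
  rcases Int.units_eq_one_or (Equiv.Perm.sign σ) with hh | hh <;> rw [hh] <;> simpa using hd

/-- The weight `binom(d,k) ∏_{s∈S}(k-s)`. -/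
noncomputable def wt (d : ℕ) (S : Finset ℕ) (k : ℕ) : ℂ :=
  (d.choose k : ℂ) * ∏ s ∈ S, ((k : ℂ) - s)

lemma wt_ne_zero (d : ℕ) (S : Finset ℕ) (k : ℕ) : wt d S k ≠ 0 ↔ k ≤ d ∧ k ∉ S := by
  rw [wt, mul_ne_zero_iff, Finset.prod_ne_zero_iff]
  refine and_congr ?_ ?_
  · rw [Nat.cast_ne_zero, Nat.choose_ne_zero_iff]
  · constructor
    · intro h hk
      exact h k hk (sub_self _)
    · intro h s hs h0
      rw [sub_eq_zero, Nat.cast_inj] at h0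
      exact h (h0 ▸ hs)

lemma wt_poly (d : ℕ) (S : Finset ℕ) : ∀ e : ℕ, e + S.card = d →
    ∃ h : ℂ[X], h.eval (-1) ≠ 0 ∧ ∀ k, ((X + 1) ^ e * h).coeff k = wt d S k := by
  induction S using Finset.induction_on with
  | empty =>
    intro e he
    refine ⟨1, by simp, fun k => ?_⟩
    simp only [Finset.card_empty, add_zero] at he
    subst he
    simp [wt, coeff_X_add_one_pow]
  | insert s S hs ih =>
    intro e he
    rw [Finset.card_insert_of_notMem hs] at he
    obtain ⟨h, h0, hc⟩ := ih (e + 1) (by omega)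
    refine ⟨X * (C ((e : ℂ) + 1) * h + (X + 1) * derivative h) - C (s : ℂ) * (X + 1) * h,
      ?_, fun k => ?_⟩
    · simp only [eval_sub, eval_mul, eval_X, eval_add, eval_C, eval_one]
      have : (e : ℂ) + 1 ≠ 0 := Nat.cast_add_one_ne_zero e
      have h2 : -(((e : ℂ) + 1) * eval (-1) h) ≠ 0 := neg_ne_zero.2 (mul_ne_zero this h0)
      convert h2 using 1
      ring
    · have key : (X + 1) ^ e * (X * (C ((e : ℂ) + 1) * h + (X + 1) * derivative h)
          - C (s : ℂ) * (X + 1) * h) =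
          X ^ 1 * derivative^[1] ((X + 1) ^ (e + 1) * h) - C (s : ℂ) * ((X + 1) ^ (e + 1) * h) := by
        simp only [Function.iterate_one, derivative_mul, derivative_pow, derivative_add,
          derivative_X, derivative_one, Nat.cast_add, Nat.cast_one, Nat.add_sub_cancel]
        simp only [map_add, map_one]
        ring
      rw [key, coeff_sub, coeff_X_pow_mul_iter, coeff_C_mul, hc, wt, wt,
        Finset.prod_insert hs, Nat.descFactorial_one]
      ring

/-- Existence for special Schubert intersections.  Let `N ≥ 1` and let
`d_1, …, d_N, d` (encoded as `D : Fin (N+1) → ℕ` with `D (last) = d`) and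
`ρ_1, …, ρ_N` (encoded as `ρ : Fin N → ℕ`, `ρ ⟨i-1⟩ = ρ_i`) satisfy the interleaving
`d_i < ρ_{N+1−i} ≤ d_{i+1}` for `1 ≤ i ≤ N` (with `d_{N+1} = d`).  With
`m = d + (d_1+⋯+d_N) − (ρ_1+⋯+ρ_N)` one has `m ≥ 0`, and there is an
`(N+1)`-dimensional subspace `V` of polynomials of degree at most `d` such that:
(i) the degrees of nonzero elements of `V` are exactly `{d_1, …, d_N, d}`;
(ii) the root multiplicities at `0` of nonzero elements of `V` are exactly
`{0, ρ_N, …, ρ_1}`; (iii) `V` contains a polynomial with root multiplicity `m+N`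
at `−1`; and (iv) the Wronskian of any basis of `V` equals
`c · x^{ρ_1+⋯+ρ_N − N(N+1)/2} · (x+1)^m` for some nonzero constant `c`. -/
theorem special_schubert_intersection_exists (N d : ℕ) (hN : 1 ≤ N)
    (D : Fin (N + 1) → ℕ) (hDlast : D (Fin.last N) = d)
    (ρ : Fin N → ℕ)
    (hinter : ∀ i : Fin N, D i.castSucc < ρ i.rev ∧ ρ i.rev ≤ D i.succ)
    (m : ℤ)
    (hm : m = (d : ℤ) + (∑ i : Fin N, (D i.castSucc : ℤ)) - ∑ i : Fin N, (ρ i : ℤ)) :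
    0 ≤ m ∧
    ∃ V : Submodule ℂ (Polynomial ℂ),
      V ≤ Polynomial.degreeLE ℂ (d : WithBot ℕ) ∧
      Module.finrank ℂ V = N + 1 ∧
      {k : ℕ | ∃ g ∈ V, g ≠ 0 ∧ g.natDegree = k} = Set.range D ∧
      {k : ℕ | ∃ g ∈ V, g ≠ 0 ∧ Polynomial.rootMultiplicity 0 g = k}
        = insert 0 (Set.range ρ) ∧
      (∃ p ∈ V, p ≠ 0 ∧ Polynomial.rootMultiplicity (-1) p = m.toNat + N) ∧
      (∀ f : Fin (N + 1) → Polynomial ℂ, LinearIndependent ℂ f →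
        Submodule.span ℂ (Set.range f) = V →
        ∃ c : ℂ, c ≠ 0 ∧
          polyWronskian f
            = Polynomial.C c * Polynomial.X ^ ((∑ i, ρ i) - N * (N + 1) / 2)
                * (Polynomial.X + 1) ^ m.toNat) := by
  obtain ⟨R, hR⟩ : ∃ R : Fin (N + 1) → ℕ, R = Fin.cons 0 (fun i => ρ i.rev) := ⟨_, rfl⟩
  have hR0 : R 0 = 0 := by rw [hR]; rfl
  have hRs : ∀ i : Fin N, R i.succ = ρ i.rev := by intro i; rw [hR]; rfl
  have hle : ∀ i, R i ≤ D i := by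
    intro i
    refine Fin.cases ?_ (fun j => ?_) i
    · rw [hR0]; exact Nat.zero_le _
    · rw [hRs]; exact (hinter j).2
  have hDmono : StrictMono D := by
    rw [Fin.strictMono_iff_lt_succ]
    intro i
    exact lt_of_lt_of_le (hinter i).1 (hinter i).2
  have hlt : ∀ i j, i < j → D i < R j := by
    intro i j
    refine Fin.cases ?_ (fun j => ?_) j
    · intro h; exact absurd h (Fin.not_lt_zero i)
    · intro h
      rw [hRs]
      exact lt_of_le_of_lt (hDmono.monotone (Fin.le_castSucc_iff.2 h)) (hinter j).1
  have hDd : ∀ i, D i ≤ d := fun i => hDlast ▸ hDmono.monotone (Fin.le_last i)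
  have hsumR : ∑ i, R i = ∑ i, ρ i := by
    rw [Fin.sum_univ_succ, hR0, zero_add]
    simp only [hRs]
    exact Equiv.sum_comp Fin.revPerm ρ
  obtain ⟨M, hM⟩ : ∃ M : ℕ, M = ∑ i, (D i - R i) := ⟨_, rfl⟩
  have hMsum : M + ∑ i, R i = ∑ i, D i := by
    rw [hM, ← Finset.sum_add_distrib]
    exact Finset.sum_congr rfl fun i _ => Nat.sub_add_cancel (hle i)
  have hmM : m = M := by
    have h1 : ((M + ∑ i, R i : ℕ) : ℤ) = ((∑ i, D i : ℕ) : ℤ) := by rw [hMsum]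
    rw [hsumR, Fin.sum_univ_castSucc, hDlast] at h1
    push_cast at h1
    rw [hm]; linarith
  have hmt : m.toNat = M := by rw [hmM]; simp
  refine ⟨by rw [hmM]; positivity, ?_⟩
  -- the gap set
  classical
  let B : Finset ℕ := Finset.univ.biUnion fun i => Finset.Icc (R i) (D i)
  have hBmem : ∀ k, k ∈ B ↔ ∃ i, R i ≤ k ∧ k ≤ D i := by
    intro k; simp [B]
  let S : Finset ℕ := Finset.range (d + 1) \ B
  have hBsub : B ⊆ Finset.range (d + 1) := by
    intro k hk
    obtain ⟨i, h1, h2⟩ := (hBmem k).1 hk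
    have := hDd i
    simp; omega
  have hBcard : B.card = M + (N + 1) := by
    rw [Finset.card_biUnion]
    · have : ∀ i, (Finset.Icc (R i) (D i)).card = (D i - R i) + 1 := by
        intro i
        have := hle i
        rw [Nat.card_Icc]; omega
      simp only [this, Finset.sum_add_distrib, hM]
      simp
    · intro i _ j _ hij
      rw [Function.onFun, Finset.disjoint_left]
      intro k h1 h2
      rw [Finset.mem_Icc] at h1 h2
      rcases lt_or_gt_of_ne hij with hl | hl
      · have := hlt _ _ hl; omega
      · have := hlt _ _ hl; omega
  have hScard : (M + N) + S.card = d := by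
    have := Finset.card_sdiff_add_card_eq_card hBsub
    rw [hBcard, Finset.card_range] at this
    change S.card + _ = _ at this
    omega
  have hwt : ∀ k, wt d S k ≠ 0 ↔ ∃ i, R i ≤ k ∧ k ≤ D i := by
    intro k
    rw [wt_ne_zero, ← hBmem]
    simp only [S, Finset.mem_sdiff, Finset.mem_range, not_and, not_not]
    constructor
    · rintro ⟨h1, h2⟩; exact h2 (by omega)
    · intro h
      have := Finset.mem_range.1 (hBsub h)
      exact ⟨by omega, fun _ => h⟩
  obtain ⟨p, hp⟩ : ∃ p : Fin (N + 1) → ℂ[X],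
      p = fun i => ∑ k ∈ Finset.Icc (R i) (D i), monomial k (wt d S k) := ⟨_, rfl⟩
  have hpc : ∀ i k, (p i).coeff k = if R i ≤ k ∧ k ≤ D i then wt d S k else 0 := by
    intro i k
    rw [hp]
    simp [coeff_monomial]
  have hb : Blocks p R D := by
    refine ⟨hle, hlt, fun i k => ?_⟩
    rw [hpc]
    split_ifs with h
    · simp only [h, and_self, iff_true]
      exact (hwt k).2 ⟨i, h⟩
    · simp [h]
  obtain ⟨h, h0, hc⟩ := wt_poly d S (M + N) hScard
  have hsum : ∑ i, p i = (X + 1) ^ (M + N) * h := by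
    ext k
    rw [hc]
    by_cases hk : wt d S k = 0
    · rw [hk, finsetSum_coeff]
      apply Finset.sum_eq_zero
      intro i _
      rw [hpc, hk, ite_self]
    · obtain ⟨i, hi⟩ := (hwt k).1 hk
      have := hb.coeff_comb (fun _ => 1) hi
      simp only [one_smul, one_mul] at this
      rw [this, hpc, if_pos hi]
  have hX1 : (X + 1 : ℂ[X]) = X - C (-1) := by simp
  have hh0 : h ≠ 0 := by rintro rfl; simp at h0
  refine ⟨Submodule.span ℂ (Set.range p), ?_, ?_, hb.degrees, ?_, ?_, ?_⟩
  · rw [Submodule.span_le]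
    rintro _ ⟨i, rfl⟩
    rw [SetLike.mem_coe, mem_degreeLE, ← natDegree_le_iff_degree_le, hb.natDegree]
    exact hDd i
  · rw [finrank_span_eq_card hb.linInd, Fintype.card_fin]
  · rw [hb.mults]
    ext k
    constructor
    · rintro ⟨i, rfl⟩
      refine Fin.cases ?_ (fun j => ?_) i
      · left; exact hR0
      · right; exact ⟨j.rev, (hRs j).symm⟩
    · rintro (rfl | ⟨j, rfl⟩)
      · exact ⟨0, hR0⟩
      · exact ⟨j.rev.succ, by rw [hRs, Fin.rev_rev]⟩
  · refine ⟨∑ i, p i, Submodule.sum_mem _ fun i _ => Submodule.subset_span ⟨i, rfl⟩, ?_, ?_⟩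
    · rw [hsum, hX1]
      exact mul_ne_zero (pow_ne_zero _ (X_sub_C_ne_zero _)) hh0
    · rw [hsum, mul_comm, hX1, rootMultiplicity_mul_X_sub_C_pow hh0, hmt,
        rootMultiplicity_eq_zero h0, zero_add]
  · -- Wronskian
    obtain ⟨H, H0, hH, hdeg⟩ := hb.wronskian_factor
    have hdvd : (X + 1) ^ M ∣ polyWronskian p := by
      apply dvd_wronskian p 0 M
      rw [hsum]
      exact dvd_mul_right _ _
    have hcop : IsCoprime ((X + 1 : ℂ[X]) ^ M) (X ^ (∑ i, R i)) := by
      apply IsCoprime.pow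
      exact ⟨1, -1, by ring⟩
    have hdH : (X + 1 : ℂ[X]) ^ M ∣ H := by
      apply hcop.dvd_of_dvd_mul_left
      rw [← hH]
      exact dvd_mul_of_dvd_right hdvd _
    obtain ⟨u, rfl⟩ := hdH
    have hu0 : u ≠ 0 := by rintro rfl; simp at H0
    have hmon : ((X + 1 : ℂ[X]) ^ M).Monic := by rw [hX1]; exact (monic_X_sub_C _).pow _
    have hu : u.natDegree = 0 := by
      rw [hH, (monic_X_pow _).natDegree_mul' (mul_ne_zero hmon.ne_zero hu0),
        hmon.natDegree_mul' hu0, natDegree_X_pow, hX1, natDegree_pow, natDegree_X_sub_C] at hdeg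
      omega
    obtain ⟨c, rfl⟩ : ∃ c, u = C c := ⟨_, eq_C_of_natDegree_eq_zero hu⟩
    have hc0 : c ≠ 0 := by rintro rfl; simp at hu0
    have hE : ∑ j : Fin (N + 1), (j : ℕ) = N * (N + 1) / 2 := by
      rw [Fin.sum_univ_eq_sum_range (fun i => i), Finset.sum_range_id, Nat.add_sub_cancel,
        mul_comm]
    have hEle : ∑ j : Fin (N + 1), (j : ℕ) ≤ ∑ i, R i := by
      apply Finset.sum_le_sum
      intro i _
      induction i using Fin.induction with
      | zero => simp
      | succ i ih =>
        have h1 := hb.strictMono (Fin.castSucc_lt_succ (i := i))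
        have h2 := ih (Finset.mem_univ _)
        rw [Fin.val_castSucc] at h2
        rw [Fin.val_succ]
        omega
    have hW : polyWronskian p = C c * X ^ ((∑ i, ρ i) - N * (N + 1) / 2) * (X + 1) ^ M := by
      rw [← hE, ← hsumR]
      apply mul_left_cancel₀ (pow_ne_zero (∑ j : Fin (N + 1), (j : ℕ)) (X_ne_zero (R := ℂ)))
      rw [hH]
      conv_lhs => rw [← Nat.add_sub_cancel' hEle, pow_add]
      ring
    have hWne : polyWronskian p ≠ 0 := by
      rw [hW]
      exact mul_ne_zero (mul_ne_zero (C_ne_zero.2 hc0) (pow_ne_zero _ X_ne_zero)) hmon.ne_zero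
    intro f hf hspan
    have hfA : ∀ i, ∃ a : Fin (N + 1) → ℂ, ∑ j, a j • p j = f i := fun i =>
      (Submodule.mem_span_range_iff_exists_fun ℂ).1 (hspan ▸ Submodule.subset_span ⟨i, rfl⟩)
    have hpB : ∀ i, ∃ a : Fin (N + 1) → ℂ, ∑ j, a j • f j = p i := fun i =>
      (Submodule.mem_span_range_iff_exists_fun ℂ).1 (hspan ▸ Submodule.subset_span ⟨i, rfl⟩)
    choose A hA using hfA
    choose A' hA' using hpB
    have w1 := wronskian_comb f p (Matrix.of A) (fun i => (hA i).symm)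
    have w2 := wronskian_comb p f (Matrix.of A') (fun i => (hA' i).symm)
    have hdet : (Matrix.of A).det ≠ 0 := by
      intro hz
      rw [hz, C_0, zero_mul] at w1
      rw [w1, mul_zero] at w2
      exact hWne w2
    refine ⟨(Matrix.of A).det * c, mul_ne_zero hdet hc0, ?_⟩
    rw [w1, hW, hmt, C_mul]
    ring
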